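/- arXiv:1502.05831 — 10 statements merged into one kernel-verified Lean document; each statement's English description precedes it below -/
import Mathlib

section
/- Let p_correct, p_crash, p_synchrony be real numbers in [0,1] with p_benign = p_correct + p_crash ≤ 1, and let p_available = p_correct · p_synchrony. Then p_benign³ + 3(1 − p_benign)·p_available² > p_benign⁴ + 4(1 − p_benign)·p_benign³ if and only if p_available² > p_benign³ (equivalently, p_available > p_benign^{3/2}). That is, for fault threshold t = 1, XPaxos (on 3 replicas) has strictly higher consistency probability than asynchronous BFT (on 4 replicas) exactly when the probability that a machine is available exceeds the 1.5-th power of the probability that a machine is benign. -/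
/-- For fault threshold `t = 1`, XPaxos (3 replicas) has strictly higher consistency
probability than asynchronous BFT (4 replicas) iff `p_available² > p_benign³`
(equivalently, `p_available > p_benign ^ (3/2)`). -/
theorem xpaxos_consistency_gt_bft_iff_t1
    (p_correct p_crash p_synchrony : ℝ)
    (hc0 : 0 ≤ p_correct) (hc1 : p_correct ≤ 1)
    (hcr0 : 0 ≤ p_crash) (hcr1 : p_crash ≤ 1)
    (hs0 : 0 ≤ p_synchrony) (hs1 : p_synchrony ≤ 1)
    (p_benign p_available : ℝ)
    (hb : p_benign = p_correct + p_crash) (hb1 : p_benign ≤ 1)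
    (ha : p_available = p_correct * p_synchrony) :
    (p_benign ^ 3 + 3 * (1 - p_benign) * p_available ^ 2 >
        p_benign ^ 4 + 4 * (1 - p_benign) * p_benign ^ 3) ↔
      p_available ^ 2 > p_benign ^ 3 := by
  have key : p_benign ^ 3 + 3 * (1 - p_benign) * p_available ^ 2 -
      (p_benign ^ 4 + 4 * (1 - p_benign) * p_benign ^ 3) =
      3 * (1 - p_benign) * (p_available ^ 2 - p_benign ^ 3) := by ring
  rw [gt_iff_lt, gt_iff_lt, ← sub_pos, key, ← sub_pos (a := p_available ^ 2)]
  rcases hb1.lt_or_eq with hlt | rfl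
  · exact mul_pos_iff_of_pos_left (by linarith)
  · have ha0 : 0 ≤ p_available := ha ▸ mul_nonneg hc0 hs0
    have ha1 : p_available ≤ 1 := ha ▸ mul_le_one₀ hc1 hs0 hs1
    have hsq : p_available ^ 2 ≤ 1 := pow_le_one₀ ha0 ha1
    constructor <;> intro h <;> linarith
end

section
/- For every integer t ≥ 1 and all real numbers p_correct, p_crash, p_synchrony in [0,1] with p_benign = p_correct + p_crash ≤ 1, the consistency probability of XPaxos satisfies P_XFT(t) ≥ p_benign^{2t+1} = P_CFT(2t+1); moreover the inequality is strict whenever p_benign < 1, p_correct > 0 and p_synchrony > 0. That is, XFT provides at least (and generically strictly stronger) consistency guarantees than asynchronous CFT on the same number n = 2t+1 of replicas. -/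
open Finset in
/-- The consistency probability of XPaxos on `2t+1` replicas. -/
noncomputable def P_XFT (t : ℕ) (p_crash p_correct p_synchrony : ℝ) : ℝ :=
  (p_correct + p_crash) ^ (2 * t + 1) +
    ∑ i ∈ Icc 1 t, ((2 * t + 1).choose i : ℝ) * (1 - (p_correct + p_crash)) ^ i *
      ∑ j ∈ range (t - i + 1), ((2 * t + 1 - i).choose j : ℝ) *
          p_crash ^ j * p_correct ^ (2 * t + 1 - i - j) *
        ∑ k ∈ range (t - i - j + 1), ((2 * t + 1 - i - j).choose k : ℝ) *
          p_synchrony ^ (2 * t + 1 - i - j - k) * (1 - p_synchrony) ^ k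

/-- XFT provides at least (and generically strictly stronger) consistency guarantees than
asynchronous CFT on the same number `n = 2t+1` of replicas:
`P_XFT(t) ≥ p_benign^(2t+1) = P_CFT(2t+1)`, strictly whenever `p_benign < 1`,
`p_correct > 0` and `p_synchrony > 0`. -/
theorem xpaxos_consistency_ge_cft
    (t : ℕ) (ht : 1 ≤ t)
    (p_correct p_crash p_synchrony : ℝ)
    (hc0 : 0 ≤ p_correct) (hc1 : p_correct ≤ 1)
    (hcr0 : 0 ≤ p_crash) (hcr1 : p_crash ≤ 1)
    (hs0 : 0 ≤ p_synchrony) (hs1 : p_synchrony ≤ 1)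
    (p_benign : ℝ) (hb : p_benign = p_correct + p_crash) (hb1 : p_benign ≤ 1) :
    P_XFT t p_crash p_correct p_synchrony ≥ p_benign ^ (2 * t + 1) ∧
      (p_benign < 1 → 0 < p_correct → 0 < p_synchrony →
        P_XFT t p_crash p_correct p_synchrony > p_benign ^ (2 * t + 1)) := by
  subst hb
  have hq : 0 ≤ 1 - (p_correct + p_crash) := by linarith
  have hs : 0 ≤ 1 - p_synchrony := by linarith
  unfold P_XFT
  constructor
  · exact le_add_of_nonneg_right (Finset.sum_nonneg fun i _ => by positivity)
  · intro hb hc hsync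
    have hq' : 0 < 1 - (p_correct + p_crash) := by linarith
    refine lt_add_of_pos_right _ (Finset.sum_pos' (fun i _ => by positivity)
      ⟨1, Finset.mem_Icc.2 ⟨le_rfl, ht⟩, ?_⟩)
    have hchoose : 0 < (2 * t + 1).choose 1 := Nat.choose_pos (by lia)
    refine mul_pos (by positivity) (Finset.sum_pos' (fun j _ => by positivity) ⟨0, by simp, ?_⟩)
    refine mul_pos ?_ (Finset.sum_pos' (fun k _ => by positivity) ⟨0, by simp, ?_⟩)
    · simpa using pow_pos hc _
    · simpa using pow_pos hsync _
end

section
/- For every integer t ≥ 1 and all real numbers p_available, p_benign with 0 ≤ p_available ≤ p_benign ≤ 1, Σ_{i=t+1}^{2t+1} C(2t+1,i) p_available^i (1 − p_available)^{2t+1−i} ≥ Σ_{i=t+1}^{2t+1} C(2t+1,i) p_available^i (p_benign − p_available)^{2t+1−i}; moreover the inequality is strict whenever p_available > 0 and p_benign < 1. That is, the availability probability of XPaxos is at least (and generically strictly greater than) that of an asynchronous CFT protocol on the same 2t+1 replicas. -/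
open Finset in
/-- The availability probability of XPaxos on `2t+1` replicas is at least (and generically
strictly greater than) that of an asynchronous CFT protocol on the same `2t+1` replicas. -/
theorem xpaxos_availability_ge_cft
    (t : ℕ) (ht : 1 ≤ t)
    (p_available p_benign : ℝ)
    (ha0 : 0 ≤ p_available) (hab : p_available ≤ p_benign) (hb1 : p_benign ≤ 1) :
    (∑ i ∈ Icc (t + 1) (2 * t + 1), ((2 * t + 1).choose i : ℝ) *
        p_available ^ i * (1 - p_available) ^ (2 * t + 1 - i)) ≥
      (∑ i ∈ Icc (t + 1) (2 * t + 1), ((2 * t + 1).choose i : ℝ) *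
        p_available ^ i * (p_benign - p_available) ^ (2 * t + 1 - i)) ∧
    (0 < p_available → p_benign < 1 →
      (∑ i ∈ Icc (t + 1) (2 * t + 1), ((2 * t + 1).choose i : ℝ) *
          p_available ^ i * (1 - p_available) ^ (2 * t + 1 - i)) >
        (∑ i ∈ Icc (t + 1) (2 * t + 1), ((2 * t + 1).choose i : ℝ) *
          p_available ^ i * (p_benign - p_available) ^ (2 * t + 1 - i))) := by
  have hsub : 0 ≤ p_benign - p_available := sub_nonneg.2 hab
  have hle : ∀ i ∈ Icc (t + 1) (2 * t + 1),
      ((2 * t + 1).choose i : ℝ) * p_available ^ i *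
          (p_benign - p_available) ^ (2 * t + 1 - i) ≤
        ((2 * t + 1).choose i : ℝ) * p_available ^ i *
          (1 - p_available) ^ (2 * t + 1 - i) := by
    intro i _
    gcongr
  refine ⟨sum_le_sum hle, fun ha hb ↦ sum_lt_sum hle ⟨2 * t, ?_, ?_⟩⟩
  · rw [mem_Icc]
    omega
  · have hchoose : (0 : ℝ) < (2 * t + 1).choose (2 * t) := by
      exact_mod_cast Nat.choose_pos (Nat.le_succ _)
    have hexp : 2 * t + 1 - 2 * t = 1 := by omega
    rw [hexp, pow_one, pow_one]
    gcongr
end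

section
/- For every integer t ≥ 1 and every real p ∈ [0,1], Σ_{i=t+1}^{2t+1} C(2t+1,i) p^i (1 − p)^{2t+1−i} ≥ Σ_{i=2t+1}^{3t+1} C(3t+1,i) p^i (1 − p)^{3t+1−i}. That is, with each replica independently available with probability p, the probability that at least t+1 out of 2t+1 replicas are available (XPaxos availability) is at least the probability that at least 2t+1 out of 3t+1 replicas are available (asynchronous BFT availability). -/
open Finset in
/-- The probability of at least `k + 1` successes in `n + 1` independent trials is at most that of
at least `k` successes in `n` trials. -/
theorem binomial_tail_succ_succ_le (n k : ℕ) (hk : k ≤ n)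
    (p : ℝ) (hp0 : 0 ≤ p) (hp1 : p ≤ 1) :
    (∑ i ∈ Icc (k + 1) (n + 1), ((n + 1).choose i : ℝ) * p ^ i * (1 - p) ^ (n + 1 - i)) ≤
      ∑ i ∈ Icc k n, (n.choose i : ℝ) * p ^ i * (1 - p) ^ (n - i) := by
  have hq : 0 ≤ 1 - p := sub_nonneg.2 hp1
  set f : ℕ → ℝ := fun i => (n.choose i : ℝ) * p ^ i * (1 - p) ^ (n - i) with hf
  have shift (g : ℕ → ℝ) : ∑ i ∈ Icc (k + 1) (n + 1), g i = ∑ i ∈ Icc k n, g (i + 1) := by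
    rw [← map_add_right_Icc, sum_map]
    rfl
  have pascal : ∀ j ∈ Icc k n, ((n + 1).choose (j + 1) : ℝ) * p ^ (j + 1) *
      (1 - p) ^ (n + 1 - (j + 1)) = p * f j + (1 - p) * f (j + 1) := by
    intro j hj
    rcases (mem_Icc.1 hj).2.eq_or_lt with rfl | hlt
    · simp [hf, pow_succ, mul_comm]
    · obtain ⟨m, rfl⟩ := Nat.exists_eq_add_of_lt hlt
      have h1 : j + m + 1 + 1 - (j + 1) = m + 1 := by lia
      have h2 : j + m + 1 - j = m + 1 := by lia
      have h3 : j + m + 1 - (j + 1) = m := by lia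
      simp only [hf, h1, h2, h3, Nat.choose_succ_succ' (j + m + 1) j, Nat.cast_add]
      ring
  have tail_le : ∑ j ∈ Icc k n, f (j + 1) ≤ ∑ j ∈ Icc k n, f j := by
    have htop : ∑ j ∈ Icc k (n + 1), f j = ∑ j ∈ Icc k n, f j := by
      rw [sum_Icc_succ_top (by lia)]
      simp [hf]
    rw [← shift f, ← htop]
    refine sum_le_sum_of_subset_of_nonneg (Icc_subset_Icc_left k.le_succ) fun i _ _ => ?_
    simp only [hf]
    positivity
  rw [shift, sum_congr rfl pascal, sum_add_distrib, ← mul_sum, ← mul_sum]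
  linarith [mul_le_mul_of_nonneg_left tail_le hq]

open Finset in
/-- Adding `m` trials and requiring `m` more successes does not increase the binomial tail. -/
theorem binomial_tail_add_add_le (n k m : ℕ) (hk : k ≤ n)
    (p : ℝ) (hp0 : 0 ≤ p) (hp1 : p ≤ 1) :
    (∑ i ∈ Icc (k + m) (n + m), ((n + m).choose i : ℝ) * p ^ i * (1 - p) ^ (n + m - i)) ≤
      ∑ i ∈ Icc k n, (n.choose i : ℝ) * p ^ i * (1 - p) ^ (n - i) := by
  induction m with
  | zero => exact le_rfl
  | succ m ih =>
    exact (binomial_tail_succ_succ_le (n + m) (k + m) (by lia) p hp0 hp1).trans ih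

open Finset in
/-- With each replica independently available with probability `p`, the probability that at
least `t+1` out of `2t+1` replicas are available (XPaxos availability) is at least the
probability that at least `2t+1` out of `3t+1` replicas are available (asynchronous BFT
availability). -/
theorem xpaxos_availability_ge_bft (t : ℕ) (ht : 1 ≤ t)
    (p : ℝ) (hp0 : 0 ≤ p) (hp1 : p ≤ 1) :
    (∑ i ∈ Icc (t + 1) (2 * t + 1), ((2 * t + 1).choose i : ℝ) *
        p ^ i * (1 - p) ^ (2 * t + 1 - i)) ≥
      (∑ i ∈ Icc (2 * t + 1) (3 * t + 1), ((3 * t + 1).choose i : ℝ) *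
        p ^ i * (1 - p) ^ (3 * t + 1 - i)) := by
  have h := binomial_tail_add_add_le (2 * t + 1) (t + 1) t (by lia) p hp0 hp1
  rwa [show t + 1 + t = 2 * t + 1 by ring, show 2 * t + 1 + t = 3 * t + 1 by ring] at h
end

section
/- Let b, c, s be integers with 1 ≤ b, c, s ≤ 20 and b ≥ c. Set p_benign = 1 − 10^{−b}, p_correct = 1 − 10^{−c}, p_crash = p_benign − p_correct, p_synchrony = 1 − 10^{−s}. Then 9of(P_XFT(1)) − 9of(P_CFT(3)) equals c − 1 if (b > s and s = c), and equals min(s, c) otherwise, where P_XFT(1) = p_benign³ + 3(1 − p_benign)·p_correct²·p_synchrony² and P_CFT(3) = p_benign³. -/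
/-- The number of nines of a probability `p`: `⌊-log₁₀ (1 - p)⌋`. -/
noncomputable def ninesOf (p : ℝ) : ℤ := ⌊-(Real.logb 10 (1 - p))⌋

theorem ninesOf_eq_of_bounds {p : ℝ} {k : ℤ} (hlo : (10 : ℝ) ^ (-(k + 1)) < 1 - p)
    (hhi : 1 - p ≤ (10 : ℝ) ^ (-k)) : ninesOf p = k := by
  have hpos : 0 < 1 - p := lt_trans (by positivity) hlo
  have h1 := Real.logb_lt_logb (b := 10) (by norm_num) (by positivity) hlo
  have h2 := Real.logb_le_logb_of_le (b := 10) (by norm_num) hpos hhi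
  rw [← Real.rpow_intCast, Real.logb_rpow (by norm_num) (by norm_num)] at h1 h2
  unfold ninesOf
  rw [Int.floor_eq_iff]
  push_cast at h1 h2
  constructor <;> linarith

theorem ten_zpow_neg_le_tenth {n : ℤ} (hn : 1 ≤ n) : (10 : ℝ) ^ (-n) ≤ 1 / 10 :=
  calc (10 : ℝ) ^ (-n) ≤ (10 : ℝ) ^ (-1 : ℤ) := zpow_le_zpow_right₀ (by norm_num) (by lia)
    _ = 1 / 10 := by norm_num

theorem ten_zpow_neg_le_tenth_mul {m n : ℤ} (h : m < n) :
    (10 : ℝ) ^ (-n) ≤ (10 : ℝ) ^ (-m) / 10 :=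
  calc (10 : ℝ) ^ (-n) ≤ (10 : ℝ) ^ (-m - 1) := zpow_le_zpow_right₀ (by norm_num) (by lia)
    _ = (10 : ℝ) ^ (-m) / 10 := by rw [zpow_sub_one₀ (by norm_num)]; ring

theorem ninesOf_one_sub_cube {b : ℤ} (hb : 1 ≤ b) :
    ninesOf ((1 - (10 : ℝ) ^ (-b)) ^ 3) = b - 1 := by
  have hx : (0 : ℝ) < (10 : ℝ) ^ (-b) := by positivity
  have hx1 := ten_zpow_neg_le_tenth hb
  have e : (10 : ℝ) ^ (-(b - 1)) = (10 : ℝ) ^ (-b) * 10 := by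
    rw [← zpow_add_one₀ (by norm_num)]; congr 1; ring
  apply ninesOf_eq_of_bounds
  · rw [sub_add_cancel]
    generalize (10 : ℝ) ^ (-b) = x at *
    nlinarith [pow_pos hx 3, mul_nonneg hx.le (sub_nonneg.2 hx1)]
  · rw [e]
    generalize (10 : ℝ) ^ (-b) = x at *
    nlinarith [pow_pos hx 3, mul_nonneg hx.le (sub_nonneg.2 hx1),
      mul_nonneg (sq_nonneg x) (sub_nonneg.2 hx1)]

theorem one_sub_xft_eq (x y z : ℝ) :
    1 - ((1 - x) ^ 3 + 3 * (1 - (1 - x)) * (1 - y) ^ 2 * (1 - z) ^ 2) =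
      x * (6 * (y + z - y * z) - 3 * (y + z - y * z) ^ 2 - 3 * x + x ^ 2) := by
  ring

/-- The number of nines of XPaxos, from bounds on its inconsistency probability divided by `x`. -/
theorem ninesOf_xft_eq {b m : ℤ} {y z : ℝ}
    (hlo : (10 : ℝ) ^ (-m) < 6 * (y + z - y * z) - 3 * (y + z - y * z) ^ 2
      - 3 * (10 : ℝ) ^ (-b) + ((10 : ℝ) ^ (-b)) ^ 2)
    (hhi : 6 * (y + z - y * z) - 3 * (y + z - y * z) ^ 2
      - 3 * (10 : ℝ) ^ (-b) + ((10 : ℝ) ^ (-b)) ^ 2 ≤ 10 * (10 : ℝ) ^ (-m)) :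
    ninesOf ((1 - (10 : ℝ) ^ (-b)) ^ 3 +
      3 * (1 - (1 - (10 : ℝ) ^ (-b))) * (1 - y) ^ 2 * (1 - z) ^ 2) = b + m - 1 := by
  have hx : (0 : ℝ) < (10 : ℝ) ^ (-b) := by positivity
  have e1 : (10 : ℝ) ^ (-(b + m - 1 + 1)) = (10 : ℝ) ^ (-b) * (10 : ℝ) ^ (-m) := by
    rw [← zpow_add₀ (by norm_num)]; congr 1; ring
  have e2 : (10 : ℝ) ^ (-(b + m - 1)) = (10 : ℝ) ^ (-b) * (10 * (10 : ℝ) ^ (-m)) := by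
    rw [← zpow_one_add₀ (by norm_num), ← zpow_add₀ (by norm_num)]; congr 1; ring
  apply ninesOf_eq_of_bounds
  · rw [one_sub_xft_eq, e1]
    exact mul_lt_mul_of_pos_left hlo hx
  · rw [one_sub_xft_eq, e2]
    exact mul_le_mul_of_nonneg_left hhi hx.le

/-- For `t = 1`, the number of nines of consistency that XPaxos adds over asynchronous CFT:
`9of(P_XFT(1)) − 9of(P_CFT(3))` equals `c − 1` when `b > s` and `s = c`, and
`min s c` otherwise. -/
theorem nines_xpaxos_minus_cft_t1 (b c s : ℤ)
    (hb1 : 1 ≤ b) (hb20 : b ≤ 20) (hc1 : 1 ≤ c) (hc20 : c ≤ 20)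
    (hs1 : 1 ≤ s) (hs20 : s ≤ 20) (hbc : b ≥ c)
    (p_benign p_correct p_crash p_synchrony : ℝ)
    (hpb : p_benign = 1 - (10 : ℝ) ^ (-b))
    (hpc : p_correct = 1 - (10 : ℝ) ^ (-c))
    (hpcr : p_crash = p_benign - p_correct)
    (hps : p_synchrony = 1 - (10 : ℝ) ^ (-s)) :
    ninesOf (p_benign ^ 3 + 3 * (1 - p_benign) * p_correct ^ 2 * p_synchrony ^ 2) -
        ninesOf (p_benign ^ 3) =
      if b > s ∧ s = c then c - 1 else min s c := by
  subst hpb hpc hps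
  rw [ninesOf_one_sub_cube hb1]
  have hx : (0 : ℝ) < (10 : ℝ) ^ (-b) := by positivity
  have hy : (0 : ℝ) < (10 : ℝ) ^ (-c) := by positivity
  have hz : (0 : ℝ) < (10 : ℝ) ^ (-s) := by positivity
  have hx1 := ten_zpow_neg_le_tenth hb1
  have hy1 := ten_zpow_neg_le_tenth hc1
  have hz1 := ten_zpow_neg_le_tenth hs1
  have hxy : (10 : ℝ) ^ (-b) ≤ (10 : ℝ) ^ (-c) :=
    zpow_le_zpow_right₀ (by norm_num) (by lia)
  rcases lt_trichotomy s c with hsc | rfl | hcs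
  · rw [if_neg (by lia), min_eq_left hsc.le, ninesOf_xft_eq (m := s)]
    · ring
    all_goals
      have hyz := ten_zpow_neg_le_tenth_mul hsc
      generalize (10 : ℝ) ^ (-b) = x at *
      generalize (10 : ℝ) ^ (-c) = y at *
      generalize (10 : ℝ) ^ (-s) = z at *
      have hu : z ≤ y + z - y * z := by nlinarith
      have hu' : y + z - y * z ≤ y + z := by nlinarith
      generalize y + z - y * z = u at *
      nlinarith
  · by_cases hbs : b > s
    · have e : (10 : ℝ) ^ (-(s - 1)) = (10 : ℝ) ^ (-s) * 10 := by
        rw [← zpow_add_one₀ (by norm_num)]; congr 1; ring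
      rw [if_pos ⟨hbs, rfl⟩, ninesOf_xft_eq (m := s - 1)]
      · ring
      all_goals
        rw [e]
        have hxy' := ten_zpow_neg_le_tenth_mul hbs
        generalize (10 : ℝ) ^ (-b) = x at *
        generalize (10 : ℝ) ^ (-s) = y at *
      · have h : 0 < 17 / 10 - 18 * y + 12 * y ^ 2 - 3 * y ^ 3 := by
          nlinarith [mul_nonneg hy.le (sub_nonneg.2 hy1),
            mul_nonneg (sq_nonneg y) (sub_nonneg.2 hy1), sq_nonneg (y - 1 / 10)]
        have h' := mul_pos hy h
        nlinarith
      · nlinarith [sq_nonneg (y + y - y * y)]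
    · obtain rfl : b = s := by lia
      rw [if_neg (by lia), min_self, ninesOf_xft_eq (m := b)]
      · ring
      all_goals
        generalize (10 : ℝ) ^ (-b) = x at *
        have hu : 19 / 10 * x ≤ x + x - x * x := by nlinarith
        have hu' : x + x - x * x ≤ x + x := by nlinarith
        generalize x + x - x * x = u at *
        nlinarith
  · rw [if_neg (by lia), min_eq_right hcs.le, ninesOf_xft_eq (m := c)]
    · ring
    all_goals
      have hzy := ten_zpow_neg_le_tenth_mul hcs
      generalize (10 : ℝ) ^ (-b) = x at *
      generalize (10 : ℝ) ^ (-c) = y at *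
      generalize (10 : ℝ) ^ (-s) = z at *
      have hu : y ≤ y + z - y * z := by nlinarith
      have hu' : y + z - y * z ≤ y + z := by nlinarith
      generalize y + z - y * z = u at *
      nlinarith
end

section
/- Let b, c, s be integers with 1 ≤ b, c, s ≤ 20 and b ≥ c. Set p_benign = 1 − 10^{−b}, p_correct = 1 − 10^{−c}, p_crash = p_benign − p_correct, p_synchrony = 1 − 10^{−s}. Then 9of(P_XFT(2)) − 9of(p_benign⁵) equals 2c − 2 if (b > s and s = c > 1); equals 2c if (s > 2b and b = c); and equals 2·min(s, c) − 1 otherwise. -/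
/-- A probability `p < 1` has `n` nines when `1 - p` lies between `10 ^ (-(n + 1))`, excluded,
and `10 ^ (-n)`, included. -/
theorem ninesOf_eq_of_mem_Ioc {p : ℝ} {n : ℤ}
    (h : 1 - p ∈ Set.Ioc ((10 : ℝ) ^ (-(n + 1))) ((10 : ℝ) ^ (-n))) : ninesOf p = n := by
  obtain ⟨hl, hu⟩ := h
  have hp : 0 < 1 - p := lt_trans (by positivity) hl
  have hu' : Real.logb 10 (1 - p) ≤ -n := by
    rw [Real.logb_le_iff_le_rpow (by norm_num) hp]
    exact_mod_cast hu
  have hl' : -(n + 1 : ℝ) < Real.logb 10 (1 - p) := by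
    rw [Real.lt_logb_iff_rpow_lt (by norm_num) hp]
    exact_mod_cast hl
  rw [ninesOf, Int.floor_eq_iff]
  constructor <;> linarith

/-- Five replicas with `b ≥ 1` nines of benignity each give asynchronous CFT `b - 1` nines
of consistency. -/
theorem ninesOf_one_sub_zpow_pow_five {b : ℕ} (hb : 1 ≤ b) :
    ninesOf ((1 - (10 : ℝ) ^ (-(b : ℤ))) ^ 5) = b - 1 := by
  apply ninesOf_eq_of_mem_Ioc
  have hx : (10 : ℝ) ^ (-((b : ℤ) - 1)) = 10 * (10 : ℝ) ^ (-(b : ℤ)) := by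
    rw [neg_sub, sub_eq_add_neg, zpow_add₀ (by norm_num), zpow_one]
  have hx1 : (10 : ℝ) ^ (-(b : ℤ)) < 1 := zpow_lt_one_of_neg₀ (by norm_num) (by lia)
  have hx0 : 0 < (10 : ℝ) ^ (-(b : ℤ)) := by positivity
  rw [sub_add_cancel, hx]
  generalize (10 : ℝ) ^ (-(b : ℤ)) = x at hx0 hx1
  have hlt : (1 - x) ^ 5 < 1 - x :=
    pow_lt_self_of_lt_one₀ (by linarith) (by linarith) (by norm_num)
  have hge := one_add_mul_le_pow (show (-2 : ℝ) ≤ -x by linarith) 5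
  rw [← sub_eq_add_neg] at hge
  push_cast at hge
  constructor <;> linarith

/-- The consistency probability of XPaxos on five replicas, multiplied by `B ^ 5 * C ^ 4 * S ^ 4`,
when the benign, correct and synchronous probabilities are `1 - 1 / B`, `1 - 1 / C` and
`1 - 1 / S`. -/
def xpaxosNumerator (B C S : ℕ) : ℕ :=
  (B - 1) ^ 5 * C ^ 4 * S ^ 4 +
    5 * B ^ 4 * (C - 1) ^ 4 * ((S - 1) ^ 4 + 4 * (S - 1) ^ 3) +
    20 * B ^ 3 * (B - C) * (C - 1) ^ 3 * (S - 1) ^ 3 * S +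
    10 * B ^ 3 * C * (C - 1) ^ 3 * (S - 1) ^ 3 * S

theorem xpaxosNumerator_div {B C S : ℕ} (hC : 1 ≤ C) (hS : 1 ≤ S) (hCB : C ≤ B) :
    (xpaxosNumerator B C S : ℝ) / ((B ^ 5 * C ^ 4 * S ^ 4 : ℕ) : ℝ) =
      (1 - (B : ℝ)⁻¹) ^ 5 +
        5 * (1 - (1 - (B : ℝ)⁻¹)) *
          ((1 - (C : ℝ)⁻¹) ^ 4 *
            ((1 - (S : ℝ)⁻¹) ^ 4 + 4 * (1 - (S : ℝ)⁻¹) ^ 3 * (1 - (1 - (S : ℝ)⁻¹))) +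
            4 * (1 - (B : ℝ)⁻¹ - (1 - (C : ℝ)⁻¹)) * (1 - (C : ℝ)⁻¹) ^ 3 *
              (1 - (S : ℝ)⁻¹) ^ 3) +
        10 * (1 - (1 - (B : ℝ)⁻¹)) ^ 2 * (1 - (C : ℝ)⁻¹) ^ 3 * (1 - (S : ℝ)⁻¹) ^ 3 := by
  have hB0 : (B : ℝ) ≠ 0 := by norm_cast; lia
  have hC0 : (C : ℝ) ≠ 0 := by norm_cast; lia
  have hS0 : (S : ℝ) ≠ 0 := by norm_cast; lia
  unfold xpaxosNumerator
  push_cast [Nat.cast_sub (hC.trans hCB), Nat.cast_sub hC, Nat.cast_sub hS, Nat.cast_sub hCB]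
  field_simp
  ring

theorem ninesOf_div {P D n : ℕ} (hD : 0 < D) (hu : D * 10 ^ n ≤ D + P * 10 ^ n)
    (hl : D + P * 10 ^ (n + 1) < D * 10 ^ (n + 1)) : ninesOf ((P : ℝ) / D) = n := by
  apply ninesOf_eq_of_mem_Ioc
  have hD' : (0 : ℝ) < D := by exact_mod_cast hD
  have hq : 1 - (P : ℝ) / D = (D - P) / D := by field_simp
  have hu' : (D : ℝ) * 10 ^ n ≤ D + P * 10 ^ n := by exact_mod_cast hu
  have hl' : (D : ℝ) + P * 10 ^ (n + 1) < D * 10 ^ (n + 1) := by exact_mod_cast hl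
  rw [hq, zpow_neg, zpow_neg, ← Nat.cast_add_one, zpow_natCast, zpow_natCast]
  constructor
  · rw [lt_div_iff₀ hD', inv_mul_lt_iff₀ (by positivity)]
    linarith
  · rw [div_le_iff₀ hD', le_inv_mul_iff₀ (by positivity)]
    linarith

/-- The nines of consistency that XPaxos adds over asynchronous CFT when `t = 2`. -/
def ninesGain (b c s : ℕ) : ℕ :=
  if b > s ∧ s = c ∧ c > 1 then 2 * c - 2
  else if s > 2 * b ∧ b = c then 2 * c
  else 2 * min s c - 1

theorem xpaxosNumerator_bounds : ∀ b < 20, ∀ c < b + 1, ∀ s < 20,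
    let B := 10 ^ (b + 1)
    let C := 10 ^ (c + 1)
    let S := 10 ^ (s + 1)
    let D := B ^ 5 * C ^ 4 * S ^ 4
    let P := xpaxosNumerator B C S
    let n := b + ninesGain (b + 1) (c + 1) (s + 1)
    D * 10 ^ n ≤ D + P * 10 ^ n ∧ D + P * 10 ^ (n + 1) < D * 10 ^ (n + 1) := by
  decide +kernel

theorem ninesOf_xpaxosNumerator_div {b c s : ℕ} (hb : 1 ≤ b) (hb' : b ≤ 20) (hc : 1 ≤ c)
    (hcb : c ≤ b) (hs : 1 ≤ s) (hs' : s ≤ 20) :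
    ninesOf ((xpaxosNumerator (10 ^ b) (10 ^ c) (10 ^ s) : ℝ) /
      (((10 ^ b) ^ 5 * (10 ^ c) ^ 4 * (10 ^ s) ^ 4 : ℕ) : ℝ)) =
      (b - 1) + ninesGain b c s := by
  obtain ⟨b, rfl⟩ := Nat.exists_eq_add_of_le' hb
  obtain ⟨c, rfl⟩ := Nat.exists_eq_add_of_le' hc
  obtain ⟨s, rfl⟩ := Nat.exists_eq_add_of_le' hs
  obtain ⟨hu, hl⟩ := xpaxosNumerator_bounds b (by lia) c (by lia) s (by lia)
  rw [ninesOf_div (by positivity) hu hl]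
  push_cast
  ring

/-- For `t = 2`, the number of nines of consistency that XPaxos adds over asynchronous CFT:
`9of(P_XFT(2)) − 9of(p_benign⁵)` equals `2c − 2` when (`b > s` and `s = c > 1`),
`2c` when (`s > 2b` and `b = c`), and `2·min s c − 1` otherwise. -/
theorem nines_xpaxos_minus_cft_t2 (b c s : ℤ)
    (hb1 : 1 ≤ b) (hb20 : b ≤ 20) (hc1 : 1 ≤ c) (hc20 : c ≤ 20)
    (hs1 : 1 ≤ s) (hs20 : s ≤ 20) (hbc : b ≥ c)
    (p_benign p_correct p_crash p_synchrony : ℝ)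
    (hpb : p_benign = 1 - (10 : ℝ) ^ (-b))
    (hpc : p_correct = 1 - (10 : ℝ) ^ (-c))
    (hpcr : p_crash = p_benign - p_correct)
    (hps : p_synchrony = 1 - (10 : ℝ) ^ (-s)) :
    ninesOf (p_benign ^ 5 +
        5 * (1 - p_benign) *
          (p_correct ^ 4 * (p_synchrony ^ 4 + 4 * p_synchrony ^ 3 * (1 - p_synchrony)) +
            4 * p_crash * p_correct ^ 3 * p_synchrony ^ 3) +
        10 * (1 - p_benign) ^ 2 * p_correct ^ 3 * p_synchrony ^ 3) -
      ninesOf (p_benign ^ 5) =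
      if b > s ∧ s = c ∧ c > 1 then 2 * c - 2
      else if s > 2 * b ∧ b = c then 2 * c
      else 2 * min s c - 1 := by
  lift b to ℕ using by lia
  lift c to ℕ using by lia
  lift s to ℕ using by lia
  norm_cast at hb1 hb20 hc1 hc20 hs1 hs20 hbc
  have hP := xpaxosNumerator_div (B := 10 ^ b) (C := 10 ^ c) (S := 10 ^ s)
    (Nat.one_le_pow' _ _) (Nat.one_le_pow' _ _) (Nat.pow_le_pow_right (by norm_num) hbc)
  have hinv (k : ℕ) : (((10 ^ k : ℕ) : ℝ))⁻¹ = (10 : ℝ) ^ (-(k : ℤ)) := by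
    rw [zpow_neg, zpow_natCast, Nat.cast_pow, Nat.cast_ofNat]
  simp only [hinv] at hP
  subst hpb hpc hpcr hps
  rw [← hP, ninesOf_xpaxosNumerator_div hb1 hb20 hc1 hbc hs1 hs20,
    ninesOf_one_sub_zpow_pow_five hb1, add_sub_cancel_left, ninesGain]
  split_ifs <;> lia
end

section
/- Let a, b be integers with 1 ≤ a < b ≤ 20, and set p_available = 1 − 10^{−a} and p_benign = 1 − 10^{−b}. Then 9of(A_XFT(1)) − 9of(A_CFT(1)) = max(2a − b, 0), where A_XFT(1) = 3p_available² − 2p_available³ and A_CFT(1) = 3p_available²(p_benign − p_available) + p_available³. -/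
/-- The floor defining `ninesOf` equals `n - 1` when `1 - q` lies in `(10⁻ⁿ, 10 · 10⁻ⁿ]`. -/
theorem ninesOf_eq_sub_one {q : ℝ} {n : ℤ} (hlt : (10 : ℝ) ^ (-n) < 1 - q)
    (hle : 1 - q ≤ 10 * (10 : ℝ) ^ (-n)) : ninesOf q = n - 1 := by
  have hq : 0 < 1 - q := lt_trans (by positivity) hlt
  have hle' : 1 - q ≤ (10 : ℝ) ^ (1 - n) := by
    rwa [sub_eq_add_neg 1 n, zpow_add₀ (by norm_num), zpow_one]
  rw [← Real.rpow_intCast] at hlt hle'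
  have h₁ := (Real.lt_logb_iff_rpow_lt (by norm_num) hq).2 hlt
  have h₂ := (Real.logb_le_iff_le_rpow (by norm_num) hq).2 hle'
  push_cast at h₁ h₂
  rw [ninesOf, Int.floor_eq_iff]
  push_cast
  constructor <;> linarith

/-- For `t = 1`, the number of nines of availability that XPaxos adds over asynchronous
CFT: `9of(A_XFT(1)) − 9of(A_CFT(1)) = max (2a − b) 0`. -/
theorem nines_avail_xpaxos_minus_cft_t1 (a b : ℤ)
    (ha1 : 1 ≤ a) (hab : a < b) (hb20 : b ≤ 20)
    (p_available p_benign : ℝ)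
    (hpa : p_available = 1 - (10 : ℝ) ^ (-a))
    (hpb : p_benign = 1 - (10 : ℝ) ^ (-b)) :
    ninesOf (3 * p_available ^ 2 - 2 * p_available ^ 3) -
        ninesOf (3 * p_available ^ 2 * (p_benign - p_available) + p_available ^ 3) =
      max (2 * a - b) 0 := by
  set x : ℝ := (10 : ℝ) ^ (-a) with hx
  set y : ℝ := (10 : ℝ) ^ (-b) with hy
  have hx0 : 0 < x := by positivity
  have hy0 : 0 < y := by positivity
  have hx1 : x ≤ 1 / 10 := by
    have h : (10 : ℝ) ^ (-a) ≤ (10 : ℝ) ^ (-1 : ℤ) :=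
      zpow_le_zpow_right₀ (by norm_num) (by lia)
    norm_num at h ⊢
    simpa [hx] using h
  have hxx : (10 : ℝ) ^ (-(2 * a)) = x ^ 2 := by
    rw [hx, ← zpow_natCast, ← zpow_mul]
    congr 1
    push_cast
    ring
  have hx2 : 0 < x ^ 2 := by positivity
  have hx3 : x ^ 2 * x ≤ x ^ 2 * (1 / 10) := by gcongr
  have hx3' : 0 < x ^ 2 * x := by positivity
  have hp₁ : 81 / 100 ≤ (1 - x) ^ 2 := by nlinarith
  have hp₂ : (1 - x) ^ 2 ≤ 1 := by nlinarith
  have hyp₁ : y * (81 / 100) ≤ y * (1 - x) ^ 2 := by gcongr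
  have hyp₂ : y * (1 - x) ^ 2 ≤ y * 1 := by gcongr
  have hX : 1 - (3 * p_available ^ 2 - 2 * p_available ^ 3) = 3 * x ^ 2 - 2 * (x ^ 2 * x) := by
    rw [hpa]; ring
  have hC : 1 - (3 * p_available ^ 2 * (p_benign - p_available) + p_available ^ 3) =
      3 * x ^ 2 - 2 * (x ^ 2 * x) + 3 * (y * (1 - x) ^ 2) := by
    rw [hpa, hpb]; ring
  rw [ninesOf_eq_sub_one (n := 2 * a) (by rw [hX, hxx]; linarith) (by rw [hX, hxx]; linarith)]
  rcases le_total b (2 * a) with h | h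
  · have hxy : x ^ 2 ≤ y := by
      rw [← hxx]
      exact zpow_le_zpow_right₀ (by norm_num) (by lia)
    rw [ninesOf_eq_sub_one (n := b) (by rw [hC, ← hy]; linarith) (by rw [hC, ← hy]; linarith)]
    lia
  · have hyx : y ≤ x ^ 2 := by
      rw [← hxx]
      exact zpow_le_zpow_right₀ (by norm_num) (by lia)
    rw [ninesOf_eq_sub_one (n := 2 * a) (by rw [hC, hxx]; linarith) (by rw [hC, hxx]; linarith)]
    lia
end

section
/- Let a be an integer with 1 ≤ a ≤ 20 and set p_available = 1 − 10^{−a}. Then 9of(A_XFT(2)) = 3a − 1, where A_XFT(2) = Σ_{i=3}^{5} C(5,i) p_available^i (1 − p_available)^{5−i}. That is, for t = 2 the number of nines of availability of XPaxos equals 3·9of(p_available) − 1. -/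
/-- The probability that at least 3 of 5 independent trials fail, as a polynomial in the
failure probability `q`. -/
theorem one_sub_sum_choose_five (q : ℝ) :
    1 - ∑ i ∈ Finset.Icc 3 5, ((5).choose i : ℝ) * (1 - q) ^ i * (1 - (1 - q)) ^ (5 - i) =
      q ^ 3 * (10 - 15 * q + 6 * q ^ 2) := by
  have hIcc : Finset.Icc 3 5 = ({3, 4, 5} : Finset ℕ) := by decide
  have h3 : (5).choose 3 = 10 := by decide
  have h4 : (5).choose 4 = 5 := by decide
  rw [hIcc, Finset.sum_insert (by decide), Finset.sum_insert (by decide), Finset.sum_singleton,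
    h3, h4, Nat.choose_self]
  push_cast
  norm_num
  ring

open Finset in
/-- For `t = 2`, the number of nines of availability of XPaxos equals
`3·9of(p_available) − 1`. -/
theorem nines_avail_xpaxos_t2 (a : ℤ) (ha1 : 1 ≤ a) (ha20 : a ≤ 20)
    (p_available : ℝ) (hpa : p_available = 1 - (10 : ℝ) ^ (-a)) :
    ninesOf (∑ i ∈ Icc 3 5, ((5).choose i : ℝ) *
        p_available ^ i * (1 - p_available) ^ (5 - i)) = 3 * a - 1 := by
  subst hpa
  have hq0 : (0 : ℝ) < 10 ^ (-a) := by positivity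
  have hq1 : (10 : ℝ) ^ (-a) ≤ 1 / 10 := by
    calc (10 : ℝ) ^ (-a) ≤ 10 ^ (-1 : ℤ) := zpow_le_zpow_right₀ (by norm_num) (by lia)
      _ = 1 / 10 := by norm_num
  have hlog : Real.logb 10 ((10 : ℝ) ^ (-a)) = -a := by
    rw [← Real.rpow_intCast, Real.logb_rpow (by norm_num) (by norm_num)]
    push_cast
    rfl
  unfold ninesOf
  rw [one_sub_sum_choose_five]
  generalize (10 : ℝ) ^ (-a) = q at hq0 hq1 hlog
  have hc1 : 1 < 10 - 15 * q + 6 * q ^ 2 := by nlinarith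
  have hc10 : 10 - 15 * q + 6 * q ^ 2 ≤ 10 := by nlinarith
  have hl0 : 0 < Real.logb 10 (10 - 15 * q + 6 * q ^ 2) := Real.logb_pos (by norm_num) hc1
  have hl1 : Real.logb 10 (10 - 15 * q + 6 * q ^ 2) ≤ 1 := by
    rw [Real.logb_le_iff_le_rpow (by norm_num) (by linarith), Real.rpow_one]
    exact hc10
  rw [Real.logb_mul (by positivity) (by linarith), Real.logb_pow, hlog, Int.floor_eq_iff]
  push_cast
  constructor <;> linarith
end

section
/- Let a be an integer with 1 ≤ a ≤ 20 and set p_available = 1 − 10^{−a}. Then 9of(A_XFT(1)) = 9of(A_BFT(1)) = 2a − 1, where A_XFT(1) = 3p_available² − 2p_available³ and A_BFT(1) = 4p_available³ − 3p_available⁴. That is, for t = 1, XPaxos and asynchronous BFT achieve the same number of nines of availability, namely 2·9of(p_available) − 1. -/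
theorem ninesOf_eq_of_zpow_lt_of_le_zpow {p : ℝ} {n : ℤ}
    (hlt : (10 : ℝ) ^ (-(n + 1)) < 1 - p) (hle : 1 - p ≤ (10 : ℝ) ^ (-n)) :
    ninesOf p = n := by
  have hpos : 0 < 1 - p := lt_trans (by positivity) hlt
  have logb_zpow_ten (m : ℤ) : Real.logb 10 ((10 : ℝ) ^ m) = m := by
    rw [← Real.rpow_intCast]
    exact Real.logb_rpow (by norm_num) (by norm_num)
  have h₁ := Real.logb_lt_logb (b := 10) (by norm_num) (by positivity) hlt
  have h₂ := Real.logb_le_logb_of_le (b := 10) (by norm_num) hpos hle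
  rw [logb_zpow_ten] at h₁ h₂
  push_cast at h₁ h₂
  rw [ninesOf, Int.floor_eq_iff]
  constructor <;> linarith

/-- For `t = 1`, XPaxos and asynchronous BFT achieve the same number of nines of
availability, namely `2·9of(p_available) − 1`. -/
theorem nines_avail_xpaxos_eq_bft_t1 (a : ℤ) (ha1 : 1 ≤ a) (ha20 : a ≤ 20)
    (p_available : ℝ) (hpa : p_available = 1 - (10 : ℝ) ^ (-a)) :
    ninesOf (3 * p_available ^ 2 - 2 * p_available ^ 3) = 2 * a - 1 ∧
    ninesOf (4 * p_available ^ 3 - 3 * p_available ^ 4) = 2 * a - 1 := by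
  have hlow : (10 : ℝ) ^ (-(2 * a - 1 + 1)) = ((10 : ℝ) ^ (-a)) ^ 2 := by
    rw [← zpow_natCast, ← zpow_mul]
    congr 1
    push_cast
    ring
  have hhigh : (10 : ℝ) ^ (-(2 * a - 1)) = 10 * ((10 : ℝ) ^ (-a)) ^ 2 := by
    rw [← hlow, ← zpow_one_add₀ (by norm_num)]
    congr 1
    ring
  have hpos : 0 < (10 : ℝ) ^ (-a) := by positivity
  have hsmall : (10 : ℝ) ^ (-a) ≤ 1 / 10 := by
    calc (10 : ℝ) ^ (-a) ≤ 10 ^ (-1 : ℤ) := zpow_le_zpow_right₀ (by norm_num) (by linarith)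
      _ = 1 / 10 := by norm_num
  subst hpa
  generalize (10 : ℝ) ^ (-a) = q at *
  have hq : 0 < q ^ 2 := by positivity
  constructor <;> apply ninesOf_eq_of_zpow_lt_of_le_zpow
  · rw [hlow]
    nlinarith [mul_pos hq (show 0 < 2 - 2 * q by linarith)]
  · rw [hhigh]
    nlinarith [mul_pos hq (show 0 < 7 + 2 * q by linarith)]
  · rw [hlow]
    nlinarith [mul_pos hq (show 0 < 5 - 8 * q + 3 * q ^ 2 by linarith)]
  · rw [hhigh]
    nlinarith [mul_pos hq (show 0 < 4 + 8 * q - 3 * q ^ 2 by nlinarith)]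
end

section
/- For all integers b ≥ 1 and 2 ≤ n ≤ 9, ⌊−log₁₀(1 − (1 − 10^{−b})ⁿ)⌋ = b − 1. That is, if each of n < 10 replicas is independently benign with probability p_benign = 1 − 10^{−b} (having exactly b nines), then an asynchronous CFT protocol on those n replicas, whose consistency probability is p_benign^n, has exactly b − 1 nines of consistency: the system as a whole loses one nine relative to a single replica. -/
/-- If each of `n < 10` replicas is independently benign with probability
`1 − 10^(−b)` (exactly `b` nines), then an asynchronous CFT protocol on those `n`
replicas, with consistency probability `(1 − 10^(−b))^n`, has exactly `b − 1` nines of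
consistency: the system as a whole loses one nine relative to a single replica. -/
theorem cft_loses_one_nine (b : ℤ) (hb : 1 ≤ b) (n : ℕ) (hn2 : 2 ≤ n) (hn9 : n ≤ 9) :
    ⌊-(Real.logb 10 (1 - (1 - (10 : ℝ) ^ (-b)) ^ n))⌋ = b - 1 := by
  have hx0 : (0 : ℝ) < (10 : ℝ) ^ (-b) := by positivity
  have hx1 : (10 : ℝ) ^ (-b) < 1 := zpow_lt_one_of_neg₀ (by norm_num) (by omega)
  have hlog : Real.logb 10 ((10 : ℝ) ^ (-b)) = -b := by
    rw [← Real.rpow_intCast, Real.logb_rpow (by norm_num) (by norm_num)]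
    push_cast
    rfl
  have hlog' : Real.logb 10 (10 * (10 : ℝ) ^ (-b)) = 1 - b := by
    rw [Real.logb_mul (by norm_num) hx0.ne', hlog, Real.logb_self_eq_one (by norm_num)]
    ring
  generalize (10 : ℝ) ^ (-b) = x at *
  have hlower : x < 1 - (1 - x) ^ n := by
    have := pow_lt_self_of_lt_one₀ (show 0 < 1 - x by linarith) (by linarith)
      (show 1 < n by omega)
    linarith
  have hupper : 1 - (1 - x) ^ n ≤ 10 * x := by
    have bernoulli := one_add_mul_le_pow (show (-2 : ℝ) ≤ -x by linarith) n
    rw [← sub_eq_add_neg] at bernoulli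
    have hn : (n : ℝ) ≤ 9 := by exact_mod_cast hn9
    nlinarith
  have h₁ := Real.logb_lt_logb (b := 10) (by norm_num) hx0 hlower
  have h₂ := Real.logb_le_logb_of_le (b := 10) (by norm_num) (hx0.trans hlower) hupper
  rw [Int.floor_eq_iff]
  push_cast
  constructor <;> linarith
end
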